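/- arXiv:1610.05474 — 3 statements merged into one kernel-verified Lean document; each statement's English description precedes it below -/
import Mathlib

section
/- For every integer i ∈ ℤ, the element α^i is not a left zero-divisor in Pol(SU_{-1}(2)): for every x ∈ Pol(SU_{-1}(2)), if α^i · x = 0 then x = 0. -/
/-- Generators of `Pol(SU_{-1}(2))`: `a`, `as`, `g`, `gs` represent `α`, `α*`, `γ`, `γ*`. -/
inductive SUgen : Type
  | a | as | g | gs

open FreeAlgebra SUgen in
/-- The defining relations of `Pol(SU_{-1}(2))`. -/
inductive SUrel : FreeAlgebra ℂ SUgen → FreeAlgebra ℂ SUgen → Prop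
  | r1 : SUrel (ι ℂ as * ι ℂ a + ι ℂ gs * ι ℂ g - 1) 0
  | r2 : SUrel (ι ℂ a * ι ℂ as + ι ℂ g * ι ℂ gs - 1) 0
  | r3 : SUrel (ι ℂ g * ι ℂ gs - ι ℂ gs * ι ℂ g) 0
  | r4 : SUrel (ι ℂ a * ι ℂ g + ι ℂ g * ι ℂ a) 0
  | r5 : SUrel (ι ℂ a * ι ℂ gs + ι ℂ gs * ι ℂ a) 0
  | r6 : SUrel (ι ℂ gs * ι ℂ as + ι ℂ as * ι ℂ gs) 0
  | r7 : SUrel (ι ℂ g * ι ℂ as + ι ℂ as * ι ℂ g) 0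

/-- `Pol(SU_{-1}(2))`: the universal unital `ℂ`-algebra on `α, α*, γ, γ*` with the above
relations, i.e. the quotient of the free algebra by the two-sided ideal they generate. -/
noncomputable abbrev PolSU : Type := RingQuot SUrel

/-- The generator `α`. -/
noncomputable def SUα : PolSU := RingQuot.mkAlgHom ℂ SUrel (FreeAlgebra.ι ℂ SUgen.a)

/-- The generator `α*`. -/
noncomputable def SUαs : PolSU := RingQuot.mkAlgHom ℂ SUrel (FreeAlgebra.ι ℂ SUgen.as)

/-- The generator `γ`. -/
noncomputable def SUγ : PolSU := RingQuot.mkAlgHom ℂ SUrel (FreeAlgebra.ι ℂ SUgen.g)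

/-- The generator `γ*`. -/
noncomputable def SUγs : PolSU := RingQuot.mkAlgHom ℂ SUrel (FreeAlgebra.ι ℂ SUgen.gs)

/-- The integer power `α^i`: the usual power `α^i` for `i ≥ 0` and `(α*)^(-i)` for `i < 0`. -/
noncomputable def SUαpow (i : ℤ) : PolSU :=
  if 0 ≤ i then SUα ^ i.toNat else SUαs ^ (-i).toNat

open MvPolynomial (X)

theorem SUαs_mul_SUα_add : SUαs * SUα + SUγs * SUγ = 1 := by
  simpa [SUα, SUαs, SUγ, SUγs, sub_eq_zero] using RingQuot.mkAlgHom_rel ℂ SUrel.r1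

theorem SUα_mul_SUαs_add : SUα * SUαs + SUγ * SUγs = 1 := by
  simpa [SUα, SUαs, SUγ, SUγs, sub_eq_zero] using RingQuot.mkAlgHom_rel ℂ SUrel.r2

theorem SUγ_commute_SUγs : Commute SUγ SUγs := by
  rw [Commute, SemiconjBy]
  simpa [SUγ, SUγs, sub_eq_zero] using RingQuot.mkAlgHom_rel ℂ SUrel.r3

theorem SUγ_mul_SUα : SUγ * SUα = -(SUα * SUγ) := by
  have h := RingQuot.mkAlgHom_rel ℂ SUrel.r4
  simp only [map_add, map_mul, map_zero] at h
  exact eq_neg_of_add_eq_zero_right h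

theorem SUγs_mul_SUα : SUγs * SUα = -(SUα * SUγs) := by
  have h := RingQuot.mkAlgHom_rel ℂ SUrel.r5
  simp only [map_add, map_mul, map_zero] at h
  exact eq_neg_of_add_eq_zero_right h

theorem SUγs_mul_SUαs : SUγs * SUαs = -(SUαs * SUγs) := by
  have h := RingQuot.mkAlgHom_rel ℂ SUrel.r6
  simp only [map_add, map_mul, map_zero] at h
  exact eq_neg_of_add_eq_zero_left h

theorem SUγ_mul_SUαs : SUγ * SUαs = -(SUαs * SUγ) := by
  have h := RingQuot.mkAlgHom_rel ℂ SUrel.r7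
  simp only [map_add, map_mul, map_zero] at h
  exact eq_neg_of_add_eq_zero_left h

theorem SUα_mul_SUαs : SUα * SUαs = 1 - SUγ * SUγs :=
  eq_sub_of_add_eq SUα_mul_SUαs_add

theorem SUαs_mul_SUα : SUαs * SUα = 1 - SUγ * SUγs := by
  rw [SUγ_commute_SUγs.eq]
  exact eq_sub_of_add_eq SUαs_mul_SUα_add

theorem SUαpow_natCast (n : ℕ) : SUαpow n = SUα ^ n := by
  simp [SUαpow]

theorem SUαpow_neg_natCast (n : ℕ) : SUαpow (-n) = SUαs ^ n := by
  cases n with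
  | zero => simp [SUαpow]
  | succ n => rw [SUαpow, if_neg (by lia)]; simp

theorem mul_pow_of_mul_eq_neg {A : Type*} [Ring A] {x y : A} (h : x * y = -(y * x)) (n : ℕ) :
    x * y ^ n = (-1) ^ n * (y ^ n * x) := by
  have hx : SemiconjBy x y (-y) := by rw [SemiconjBy, h, neg_mul]
  rw [(hx.pow_right n).eq, neg_pow, mul_assoc]

theorem mul_SUαpow_of_mul_eq_neg {x : PolSU} (h : x * SUα = -(SUα * x))
    (hs : x * SUαs = -(SUαs * x)) (i : ℤ) :
    x * SUαpow i = ((i.negOnePow : ℤ) : PolSU) * (SUαpow i * x) := by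
  obtain ⟨n, rfl | rfl⟩ := i.eq_nat_or_neg
  · simp [SUαpow_natCast, mul_pow_of_mul_eq_neg h, Int.negOnePow_def]
  · simp [SUαpow_neg_natCast, mul_pow_of_mul_eq_neg hs, Int.negOnePow_def]

theorem SUα_mul_SUαpow (i : ℤ) :
    SUα * SUαpow i = SUαpow (i + 1) * if 0 ≤ i then 1 else 1 - SUγ * SUγs := by
  obtain ⟨n, rfl | rfl⟩ := i.eq_nat_or_neg
  · rw [if_pos (by lia), mul_one, SUαpow_natCast, ← pow_succ']
    exact (SUαpow_natCast (n + 1)).symm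
  · cases n with
    | zero => simp [SUαpow]
    | succ n =>
      have hc : Commute SUα SUαs := by rw [Commute, SemiconjBy, SUα_mul_SUαs, SUαs_mul_SUα]
      rw [if_neg (by lia), SUαpow_neg_natCast, (hc.pow_right _).eq, pow_succ, mul_assoc,
        SUαs_mul_SUα, ← SUαpow_neg_natCast]
      congr 2
      push_cast
      ring

theorem SUαs_mul_SUαpow (i : ℤ) :
    SUαs * SUαpow i = SUαpow (i - 1) * if i ≤ 0 then 1 else 1 - SUγ * SUγs := by
  obtain ⟨n, rfl | rfl⟩ := i.eq_nat_or_neg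
  · cases n with
    | zero => simp [SUαpow]
    | succ n =>
      have hc : Commute SUαs SUα := by rw [Commute, SemiconjBy, SUα_mul_SUαs, SUαs_mul_SUα]
      rw [if_neg (by lia), SUαpow_natCast, (hc.pow_right _).eq, pow_succ, mul_assoc,
        SUα_mul_SUαs, ← SUαpow_natCast]
      congr 2
      push_cast
      ring
  · rw [if_pos (by lia), mul_one, SUαpow_neg_natCast, ← pow_succ', ← SUαpow_neg_natCast]
    congr 1
    push_cast
    ring

/-- The polynomial ring in two commuting variables standing for `γ` and `γ*`. -/
abbrev SUγpoly : Type := MvPolynomial (Fin 2) ℂ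

/-- Evaluation of iterated polynomials at `γ` (inner variable) and `γ*` (outer variable). -/
noncomputable def SUγeval₂ : Polynomial (Polynomial ℂ) →+* PolSU :=
  Polynomial.eval₂RingHom' (Polynomial.aeval SUγ).toRingHom SUγs fun p => by
    induction p using Polynomial.induction_on' with
    | add p q hp hq => simpa using hp.add_left hq
    | monomial n c =>
      simp [Polynomial.aeval_monomial,
        (Algebra.commute_algebraMap_left c SUγs).mul_left (SUγ_commute_SUγs.pow_left n)]

/-- Evaluation of polynomials in two commuting variables at `γ` and `γ*`. -/
noncomputable def SUγeval : SUγpoly →+* PolSU :=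
  SUγeval₂.comp (MvPolynomial.eval₂Hom (Polynomial.C.comp Polynomial.C)
    ![Polynomial.C Polynomial.X, Polynomial.X])

theorem SUγeval_X_zero : SUγeval (X 0) = SUγ := by
  simp [SUγeval, SUγeval₂]

theorem SUγeval_X_one : SUγeval (X 1) = SUγs := by
  simp [SUγeval, SUγeval₂]

theorem SUγeval_C (c : ℂ) : SUγeval (MvPolynomial.C c) = algebraMap ℂ PolSU c := by
  simp [SUγeval, SUγeval₂]

/-- The free `ℂ[γ, γ*]`-module on the symbols `α^i`, `i : ℤ`. -/
abbrev SUmodule : Type := ℤ →₀ SUγpoly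

/-- The action of the generators of `Pol(SU_{-1}(2))` on `SUmodule`. -/
noncomputable def SUgenAction : SUgen → Module.End SUγpoly SUmodule
  | .a => Finsupp.linearCombination _ fun i =>
      Finsupp.single (i + 1) (if 0 ≤ i then 1 else 1 - X 0 * X 1)
  | .as => Finsupp.linearCombination _ fun i =>
      Finsupp.single (i - 1) (if i ≤ 0 then 1 else 1 - X 0 * X 1)
  | .g => Finsupp.linearCombination _ fun i =>
      Finsupp.single i (((i.negOnePow : ℤ) : SUγpoly) * X 0)
  | .gs => Finsupp.linearCombination _ fun i =>
      Finsupp.single i (((i.negOnePow : ℤ) : SUγpoly) * X 1)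

theorem intCast_negOnePow_mul_self {R : Type*} [Ring R] (i : ℤ) :
    ((i.negOnePow : ℤ) : R) * ((i.negOnePow : ℤ) : R) = 1 := by
  rw [← Int.cast_mul, ← Units.val_mul, Int.units_mul_self, Units.val_one, Int.cast_one]

theorem SUgenAction_respects {x y : FreeAlgebra ℂ SUgen} (h : SUrel x y) :
    FreeAlgebra.lift ℂ SUgenAction x = FreeAlgebra.lift ℂ SUgenAction y := by
  cases h <;>
  · simp only [map_add, map_sub, map_mul, map_one, map_zero, FreeAlgebra.lift_ι_apply]
    refine Finsupp.lhom_ext' fun i => LinearMap.ext_ring ?_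
    have hs := intCast_negOnePow_mul_self (R := SUγpoly) i
    simp only [SUgenAction, LinearMap.coe_comp, Function.comp_apply, Finsupp.lsingle_apply,
      LinearMap.add_apply, LinearMap.sub_apply, Module.End.mul_apply, Module.End.one_apply,
      LinearMap.zero_apply, Finsupp.linearCombination_single, Finsupp.smul_single, smul_eq_mul,
      one_mul, add_sub_cancel_right, sub_add_cancel, ← Finsupp.single_add, ← Finsupp.single_sub,
      Int.negOnePow_succ, Int.negOnePow_sub, Int.negOnePow_one, Units.val_neg, Int.cast_neg,
      mul_neg, mul_one]
    rw [Finsupp.single_eq_zero]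
    (try split_ifs) <;> first | lia | linear_combination (X 0 * X 1) * hs | ring

/-- The representation of `Pol(SU_{-1}(2))` on `SUmodule`. -/
noncomputable def SUaction : PolSU →ₐ[ℂ] Module.End SUγpoly SUmodule :=
  RingQuot.liftAlgHom ℂ ⟨FreeAlgebra.lift ℂ SUgenAction, fun _ _ => SUgenAction_respects⟩

theorem SUaction_mk_ι (s : SUgen) :
    SUaction (RingQuot.mkAlgHom ℂ SUrel (FreeAlgebra.ι ℂ s)) = SUgenAction s := by
  simp [SUaction]

/-- The additive map sending the symbol `α^i` with coefficient `p` to `α^i * p(γ, γ*)`. -/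
noncomputable def SUmoduleEval : SUmodule →+ PolSU :=
  Finsupp.liftAddHom fun i => (AddMonoidHom.mulLeft (SUαpow i)).comp SUγeval.toAddMonoidHom

theorem SUmoduleEval_single (i : ℤ) (p : SUγpoly) :
    SUmoduleEval (Finsupp.single i p) = SUαpow i * SUγeval p := by
  simp [SUmoduleEval]

theorem SUmoduleEval_SUgenAction (s : SUgen) (v : SUmodule) :
    SUmoduleEval (SUgenAction s v) =
      RingQuot.mkAlgHom ℂ SUrel (FreeAlgebra.ι ℂ s) * SUmoduleEval v := by
  induction v using Finsupp.induction_linear with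
  | zero => simp
  | add v w hv hw => simp only [map_add, hv, hw, mul_add]
  | single i p =>
    cases s
    · change _ = SUα * _
      simp only [SUgenAction, Finsupp.linearCombination_single, Finsupp.smul_single, smul_eq_mul,
        SUmoduleEval_single, ← mul_assoc, SUα_mul_SUαpow, mul_comm p]
      split_ifs <;> simp [SUγeval_X_zero, SUγeval_X_one, mul_assoc]
    · change _ = SUαs * _
      simp only [SUgenAction, Finsupp.linearCombination_single, Finsupp.smul_single, smul_eq_mul,
        SUmoduleEval_single, ← mul_assoc, SUαs_mul_SUαpow, mul_comm p]
      split_ifs <;> simp [SUγeval_X_zero, SUγeval_X_one, mul_assoc]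
    · change _ = SUγ * _
      simp only [SUgenAction, Finsupp.linearCombination_single, Finsupp.smul_single, smul_eq_mul,
        SUmoduleEval_single, ← mul_assoc, mul_SUαpow_of_mul_eq_neg SUγ_mul_SUα SUγ_mul_SUαs,
        mul_comm p, map_mul, map_intCast, SUγeval_X_zero, (Int.cast_commute _ (SUαpow i)).eq]
    · change _ = SUγs * _
      simp only [SUgenAction, Finsupp.linearCombination_single, Finsupp.smul_single, smul_eq_mul,
        SUmoduleEval_single, ← mul_assoc, mul_SUαpow_of_mul_eq_neg SUγs_mul_SUα SUγs_mul_SUαs,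
        mul_comm p, map_mul, map_intCast, SUγeval_X_one, (Int.cast_commute _ (SUαpow i)).eq]

theorem SUmoduleEval_SUaction (x : PolSU) (v : SUmodule) :
    SUmoduleEval (SUaction x v) = x * SUmoduleEval v := by
  obtain ⟨x, rfl⟩ := RingQuot.mkAlgHom_surjective ℂ SUrel x
  induction x using FreeAlgebra.induction generalizing v with
  | grade0 c =>
    rw [AlgHom.commutes, AlgHom.commutes, Module.algebraMap_end_apply]
    induction v using Finsupp.induction_linear with
    | zero => simp
    | add v w hv hw => rw [smul_add, map_add, map_add, hv, hw, mul_add]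
    | single i p =>
      rw [Finsupp.smul_single, MvPolynomial.smul_eq_C_mul, SUmoduleEval_single, SUmoduleEval_single,
        map_mul, SUγeval_C, Algebra.left_comm]
  | grade1 s => rw [SUaction_mk_ι, SUmoduleEval_SUgenAction]
  | mul x y hx hy => rw [map_mul, map_mul, Module.End.mul_apply, hx, hy, mul_assoc]
  | add x y hx hy => rw [map_add, map_add, LinearMap.add_apply, map_add, hx, hy, add_mul]

theorem SUmoduleEval_SUaction_one (x : PolSU) :
    SUmoduleEval (SUaction x (Finsupp.single 0 1)) = x := by
  rw [SUmoduleEval_SUaction, SUmoduleEval_single]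
  simp [SUαpow]

theorem SUaction_one_sub (v : SUmodule) :
    SUaction (1 - SUγ * SUγs) v = (1 - X 0 * X 1 : SUγpoly) • v := by
  have hγ : SUaction SUγ = SUgenAction .g := SUaction_mk_ι _
  have hγs : SUaction SUγs = SUgenAction .gs := SUaction_mk_ι _
  have h : SUaction (1 - SUγ * SUγs) = (1 - X 0 * X 1 : SUγpoly) • LinearMap.id := by
    refine Finsupp.lhom_ext' fun i => LinearMap.ext_ring ?_
    have hs := intCast_negOnePow_mul_self (R := SUγpoly) i
    simp only [map_sub, map_mul, map_one, hγ, hγs, SUgenAction, LinearMap.coe_comp,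
      Function.comp_apply, Finsupp.lsingle_apply, LinearMap.sub_apply, Module.End.mul_apply,
      Module.End.one_apply, Finsupp.linearCombination_single, Finsupp.smul_single, smul_eq_mul,
      ← Finsupp.single_sub, LinearMap.smul_apply, LinearMap.id_apply, mul_one, one_mul]
    congr 1
    linear_combination -(X 0 * X 1) * hs
  rw [h, LinearMap.smul_apply, LinearMap.id_apply]

theorem eq_zero_of_one_sub_SUγ_mul_SUγs_mul_eq_zero {x : PolSU}
    (h : (1 - SUγ * SUγs) * x = 0) : x = 0 := by
  have hne : (1 - X 0 * X 1 : SUγpoly) ≠ 0 := fun h0 => by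
    simpa using congrArg (MvPolynomial.eval 0) h0
  have hv : (1 - X 0 * X 1 : SUγpoly) • SUaction x (Finsupp.single 0 1) = 0 := by
    rw [← SUaction_one_sub, ← Module.End.mul_apply, ← map_mul, h, map_zero, LinearMap.zero_apply]
  rw [← SUmoduleEval_SUaction_one x, (smul_eq_zero.mp hv).resolve_left hne, map_zero]

theorem eq_zero_of_SUα_mul_eq_zero {x : PolSU} (h : SUα * x = 0) : x = 0 :=
  eq_zero_of_one_sub_SUγ_mul_SUγs_mul_eq_zero <| by
    rw [← SUαs_mul_SUα, mul_assoc, h, mul_zero]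

theorem eq_zero_of_SUαs_mul_eq_zero {x : PolSU} (h : SUαs * x = 0) : x = 0 :=
  eq_zero_of_one_sub_SUγ_mul_SUγs_mul_eq_zero <| by
    rw [← SUα_mul_SUαs, mul_assoc, h, mul_zero]

theorem eq_zero_of_pow_mul_eq_zero {A : Type*} [Ring A] {a : A}
    (ha : ∀ x : A, a * x = 0 → x = 0) (n : ℕ) (x : A) (h : a ^ n * x = 0) : x = 0 := by
  induction n with
  | zero => simpa using h
  | succ n ih =>
    rw [pow_succ', mul_assoc] at h
    exact ih (ha _ h)

/-- For every `i : ℤ`, the element `α^i` is not a left zero-divisor in `Pol(SU_{-1}(2))`. -/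
theorem polSU_apow_not_left_zero_divisor (i : ℤ) :
    ∀ x : PolSU, SUαpow i * x = 0 → x = 0 := by
  intro x h
  rw [SUαpow] at h
  split_ifs at h
  · exact eq_zero_of_pow_mul_eq_zero (fun _ => eq_zero_of_SUα_mul_eq_zero) _ x h
  · exact eq_zero_of_pow_mul_eq_zero (fun _ => eq_zero_of_SUαs_mul_eq_zero) _ x h
end

section
/- The quotient Pol(O_n⁺)/I is a ℂ-vector space of dimension exactly 2. -/
/-- Generators of `Pol(O_n⁺)`. -/
inductive Ogen (n : ℕ) : Type
  | v : Fin n → Fin n → Ogen n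

open FreeAlgebra Ogen in
/-- The defining relations of `Pol(O_n⁺)`: `∑ k, v k i * v k j = δ_{ij}` and
`∑ k, v i k * v j k = δ_{ij}`. -/
inductive Orel (n : ℕ) : FreeAlgebra ℂ (Ogen n) → FreeAlgebra ℂ (Ogen n) → Prop
  | col (i j : Fin n) :
      Orel n (∑ k, ι ℂ (v k i : Ogen n) * ι ℂ (v k j : Ogen n)) (if i = j then 1 else 0)
  | row (i j : Fin n) :
      Orel n (∑ k, ι ℂ (v i k : Ogen n) * ι ℂ (v j k : Ogen n)) (if i = j then 1 else 0)

/-- `Pol(O_n⁺)`: the universal unital `ℂ`-algebra with `n²` generators `v i j` subject to the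
above relations. -/
noncomputable abbrev PolO (n : ℕ) : Type := RingQuot (Orel n)

/-- The generators `v i j` of `Pol(O_n⁺)`. -/
noncomputable def vO (n : ℕ) (i j : Fin n) : PolO n :=
  RingQuot.mkAlgHom ℂ (Orel n) (FreeAlgebra.ι ℂ (Ogen.v i j))

/-- The left ideal `I` of `Pol(O_n⁺)` generated by the elements
`v i j * v k l - δ_{ij} δ_{kl} 1`, so that `Pol(O_n⁺)/I` realizes
`Pol(O_n⁺) ⊗_{Pol(𝔸_n)} ℂ`. -/
noncomputable def IdealO (n : ℕ) : Submodule (PolO n) (PolO n) :=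
  Submodule.span (PolO n)
    {x : PolO n | ∃ i j k l, x = vO n i j * vO n k l - if i = j ∧ k = l then 1 else 0}

/-- The algebra homomorphism `Pol(O_n⁺) → ℂ` sending `v i j` to `δ_{ij} s`, where `s ^ 2 = 1`. -/
noncomputable def signCharacter (n : ℕ) (s : ℂ) (hs : s * s = 1) : PolO n →ₐ[ℂ] ℂ :=
  RingQuot.liftAlgHom ℂ ⟨FreeAlgebra.lift ℂ fun | .v i j => if i = j then s else 0, by
    rintro _ _ (⟨i, j⟩ | ⟨i, j⟩) <;> by_cases h : i = j <;> simp [h, hs, eq_comm (a := j)]⟩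

theorem signCharacter_vO (n : ℕ) (s : ℂ) (hs : s * s = 1) (i j : Fin n) :
    signCharacter n s hs (vO n i j) = if i = j then s else 0 := by
  simp [signCharacter, vO]

theorem signCharacter_eq_zero_of_mem (n : ℕ) (s : ℂ) (hs : s * s = 1) {x : PolO n}
    (hx : x ∈ IdealO n) : signCharacter n s hs x = 0 := by
  induction hx using Submodule.span_induction with
  | mem x hx =>
    obtain ⟨i, j, k, l, rfl⟩ := hx
    by_cases h : i = j <;> by_cases h' : k = l <;> simp [signCharacter_vO, h, h', hs]
  | zero => simp
  | add x y _ _ hx hy => simp [hx, hy]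
  | smul a x _ hx => simp [hx]

theorem vO_mul_vO_mk (n : ℕ) (i j k l : Fin n) :
    vO n i j • vO n k l • (IdealO n).mkQ 1 = if i = j ∧ k = l then (IdealO n).mkQ 1 else 0 := by
  have h : vO n i j * vO n k l - (if i = j ∧ k = l then 1 else 0) ∈ IdealO n :=
    Submodule.subset_span ⟨i, j, k, l, rfl⟩
  rw [← map_smul, ← map_smul, smul_eq_mul, smul_eq_mul, mul_one, ← sub_eq_zero]
  rw [← Submodule.Quotient.mk_eq_zero, ← Submodule.mkQ_apply, map_sub] at h
  split_ifs at h ⊢ <;> simpa using h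

theorem sum_vO_mul_vO_self (n : ℕ) (i : Fin n) : ∑ k, vO n k i * vO n k i = 1 := by
  simpa [vO] using RingQuot.mkAlgHom_rel ℂ (Orel.col i i)

theorem vO_mk (n : ℕ) (i k l : Fin n) :
    vO n k l • (IdealO n).mkQ 1 = if k = l then vO n i i • (IdealO n).mkQ 1 else 0 := by
  rw [← one_smul (PolO n) (vO n k l • _)]
  nth_rw 1 [← sum_vO_mul_vO_self n i]
  simp only [Finset.sum_smul, mul_smul, vO_mul_vO_mk]
  by_cases h : k = l <;> simp [h, smul_ite]

/-- A complex subspace of a `Pol(O_n⁺)`-module stable under the generators is a submodule. -/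
theorem smul_mem_of_vO_smul_mem {n : ℕ} {M : Type*} [AddCommGroup M] [Module (PolO n) M]
    [Module ℂ M] [IsScalarTower ℂ (PolO n) M] (N : Submodule ℂ M)
    (hN : ∀ i j, ∀ m ∈ N, vO n i j • m ∈ N) (a : PolO n) {m : M} (hm : m ∈ N) : a • m ∈ N := by
  obtain ⟨a, rfl⟩ := RingQuot.mkAlgHom_surjective ℂ (Orel n) a
  induction a using FreeAlgebra.induction generalizing m with
  | grade0 r =>
    rw [AlgHom.commutes, algebraMap_smul]
    exact N.smul_mem r hm
  | grade1 x => exact hN _ _ _ hm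
  | mul a b ha hb => rw [map_mul, mul_smul]; exact ha (hb hm)
  | add a b ha hb => rw [map_add, add_smul]; exact N.add_mem (ha hm) (hb hm)

theorem span_mk_one_vO (n : ℕ) (i : Fin n) :
    Submodule.span ℂ {(IdealO n).mkQ 1, vO n i i • (IdealO n).mkQ 1} = ⊤ := by
  refine eq_top_iff.2 fun x _ => ?_
  obtain ⟨a, rfl⟩ := (IdealO n).mkQ_surjective x
  rw [← mul_one a, ← smul_eq_mul, map_smul]
  refine smul_mem_of_vO_smul_mem _ (fun k l m hm => ?_) a (Submodule.subset_span (by simp))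
  obtain ⟨c, d, rfl⟩ := Submodule.mem_span_pair.1 hm
  rw [smul_add, smul_comm _ c, smul_comm _ d, vO_mul_vO_mk, vO_mk n i k l]
  refine Submodule.add_mem _ (Submodule.smul_mem _ _ ?_) (Submodule.smul_mem _ _ ?_) <;>
    split_ifs <;> first | exact Submodule.zero_mem _ | exact Submodule.subset_span (by simp)

/-- The quotient `Pol(O_n⁺)/I` is a `ℂ`-vector space of dimension exactly 2. -/
theorem polO_quotient_rank
    (n : ℕ) (hn : 2 ≤ n) :
    Module.rank ℂ (PolO n ⧸ IdealO n) = 2 := by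
  let i : Fin n := ⟨0, by lia⟩
  apply le_antisymm
  · rw [← rank_top, ← span_mk_one_vO n i]
    refine (rank_span_le _).trans ((Cardinal.mk_insert_le).trans ?_)
    rw [Cardinal.mk_singleton, one_add_one_eq_two]
  · let φ : PolO n →ₗ[ℂ] ℂ × ℂ :=
      (signCharacter n 1 (by simp)).toLinearMap.prod (signCharacter n (-1) (by simp)).toLinearMap
    let ψ : (PolO n ⧸ (IdealO n).restrictScalars ℂ) →ₗ[ℂ] ℂ × ℂ :=
      Submodule.liftQ _ φ fun x hx => Prod.ext
        (signCharacter_eq_zero_of_mem n _ _ hx) (signCharacter_eq_zero_of_mem n _ _ hx)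
    have hψ : Function.Surjective ψ := by
      rintro ⟨a, b⟩
      refine ⟨Submodule.Quotient.mk (((a + b) / 2) • 1 + ((a - b) / 2) • vO n i i), ?_⟩
      change φ _ = _
      ext <;> simp [φ, signCharacter_vO] <;> ring
    rw [← (Submodule.Quotient.restrictScalarsEquiv ℂ (IdealO n)).rank_eq]
    refine le_trans ?_ (LinearMap.rank_le_of_surjective ψ hψ)
    rw [rank_prod', Module.rank_self, one_add_one_eq_two]
end

section
/- The ring Pol(O_2⁺) is a domain: it is a nontrivial ring, and for all x, y ∈ Pol(O_2⁺), if x·y = 0 then x = 0 or y = 0. -/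
/-- The relations between the generators of `Pol(SL_{-1}(2))`. -/
structure SLNegOneRel {A : Type*} [Ring A] (a b c d : A) : Prop where
  ab : a * b = -(b * a)
  ac : a * c = -(c * a)
  db : d * b = -(b * d)
  dc : d * c = -(c * d)
  cb : c * b = b * c
  ad : a * d = 1 - b * c
  da : d * a = 1 - b * c

/-- The relations between the entries `x, I⁻¹ • p, I⁻¹ • r, w` of an orthogonal `2 × 2` matrix. -/
structure OrthTwoRel {A : Type*} [Ring A] (x p r w : A) : Prop where
  xr : x * x - r * r = 1
  wp : w * w - p * p = 1
  xp : x * x - p * p = 1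
  wr : w * w - r * r = 1
  xp_rw : x * p + r * w = 0
  px_wr : p * x + w * r = 0
  xr_pw : x * r + p * w = 0
  rx_wp : r * x + w * p = 0

section ChangeOfGenerators

variable {A : Type*} [Ring A] [Algebra ℂ A]

theorem OrthTwoRel.slNegOneRel {x p r w : A} (h : OrthTwoRel x p r w) :
    SLNegOneRel ((1 / 2 : ℂ) • (x + w + r - p)) ((1 / 2 : ℂ) • (x - w + r + p))
      ((1 / 2 : ℂ) • (x - w - r - p)) ((1 / 2 : ℂ) • (x + w - r + p)) := by
  obtain ⟨h1, h2, h3, h4, h5, h6, h7, h8⟩ := h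
  constructor <;> simp only [smul_mul_smul_comm, mul_add, add_mul, mul_sub, sub_mul]
  · linear_combination (norm := module) (1 / 2 : ℂ) • (-h1 - h2 + h3 + h3 + h7 + h8)
  · linear_combination (norm := module) (1 / 2 : ℂ) • (h1 - h2 - h5 - h6)
  · linear_combination (norm := module) (1 / 2 : ℂ) • (h1 - h2 + h5 + h6)
  · linear_combination (norm := module) (1 / 2 : ℂ) • (-h1 - h2 + h3 + h3 - h7 - h8)
  · linear_combination (norm := module) (1 / 2 : ℂ) • (h5 - h6 + h7 - h8)
  · linear_combination (norm := module) (1 / 2 : ℂ) • (h1 + h2 - h7 + h8)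
  · linear_combination (norm := module) (1 / 2 : ℂ) • (h1 + h2 - h5 + h6)

theorem SLNegOneRel.orthTwoRel {a b c d : A} (h : SLNegOneRel a b c d) :
    OrthTwoRel ((1 / 2 : ℂ) • (a + d + b + c)) ((1 / 2 : ℂ) • (d - a + b - c))
      ((1 / 2 : ℂ) • (a - d + b - c)) ((1 / 2 : ℂ) • (a + d - b - c)) := by
  obtain ⟨h1, h2, h3, h4, h5, h6, h7⟩ := h
  constructor <;> simp only [smul_mul_smul_comm, mul_add, add_mul, mul_sub, sub_mul,
    h1, h2, h3, h4, h5, h6, h7] <;> module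

theorem map_changeOfGenerators {B : Type*} [Ring B] [Algebra ℂ B] (φ : A →ₐ[ℂ] B)
    {x p r w : A} {a b c d : B} (hx : φ x = (1 / 2 : ℂ) • (a + d + b + c))
    (hp : φ p = (1 / 2 : ℂ) • (d - a + b - c)) (hr : φ r = (1 / 2 : ℂ) • (a - d + b - c))
    (hw : φ w = (1 / 2 : ℂ) • (a + d - b - c)) :
    φ ((1 / 2 : ℂ) • (x + w + r - p)) = a ∧ φ ((1 / 2 : ℂ) • (x - w + r + p)) = b ∧
      φ ((1 / 2 : ℂ) • (x - w - r - p)) = c ∧ φ ((1 / 2 : ℂ) • (x + w - r + p)) = d := by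
  simp only [map_smul, map_add, map_sub, hx, hp, hr, hw]
  refine ⟨?_, ?_, ?_, ?_⟩ <;> module

theorem mem_adjoin_changeOfGenerators (x p r w : A) :
    ({x, p, r, w} : Set A) ⊆ Algebra.adjoin ℂ {(1 / 2 : ℂ) • (x + w + r - p),
      (1 / 2 : ℂ) • (x - w + r + p), (1 / 2 : ℂ) • (x - w - r - p),
      (1 / 2 : ℂ) • (x + w - r + p)} := by
  generalize ha : (1 / 2 : ℂ) • (x + w + r - p) = a
  generalize hb : (1 / 2 : ℂ) • (x - w + r + p) = b
  generalize hc : (1 / 2 : ℂ) • (x - w - r - p) = c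
  generalize hd : (1 / 2 : ℂ) • (x + w - r + p) = d
  have hx : x = (1 / 2 : ℂ) • (a + d + b + c) := by
    simp only [← ha, ← hb, ← hc, ← hd]; module
  have hp : p = (1 / 2 : ℂ) • (d - a + b - c) := by
    simp only [← ha, ← hb, ← hc, ← hd]; module
  have hr : r = (1 / 2 : ℂ) • (a - d + b - c) := by
    simp only [← ha, ← hb, ← hc, ← hd]; module
  have hw : w = (1 / 2 : ℂ) • (a + d - b - c) := by
    simp only [← ha, ← hb, ← hc, ← hd]; module
  have hS := Algebra.subset_adjoin (R := ℂ) (s := {a, b, c, d})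
  generalize Algebra.adjoin ℂ {a, b, c, d} = S at *
  simp only [Set.insert_subset_iff, Set.singleton_subset_iff, SetLike.mem_coe] at hS ⊢
  obtain ⟨ha, hb, hc, hd⟩ := hS
  rw [hx, hp, hr, hw]
  exact ⟨S.smul_mem (add_mem (add_mem (add_mem ha hd) hb) hc) _,
    S.smul_mem (sub_mem (add_mem (sub_mem hd ha) hb) hc) _,
    S.smul_mem (sub_mem (add_mem (sub_mem ha hd) hb) hc) _,
    S.smul_mem (sub_mem (sub_mem (add_mem ha hd) hb) hc) _⟩

end ChangeOfGenerators

namespace SkewMonoidAlgebra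

variable {k G : Type*} [Semiring k] [Monoid G] [MulSemiringAction G k]

theorem coeff_mul_mul_of_uniqueMul {f g : SkewMonoidAlgebra k G} {a₀ b₀ : G}
    (h : UniqueMul f.support g.support a₀ b₀) :
    (f * g).coeff (a₀ * b₀) = f.coeff a₀ * a₀ • g.coeff b₀ := by
  classical
  simp_rw [coeff_mul, sum_def', ← Finset.sum_product']
  refine (Finset.sum_eq_single (a₀, b₀) ?_ ?_).trans (if_pos rfl)
  · intro ab hab hne
    rw [Finset.mem_product] at hab
    exact if_neg fun he ↦ hne (Prod.ext (h hab.1 hab.2 he).1 (h hab.1 hab.2 he).2)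
  · intro hab
    rw [Finset.mem_product, not_and_or, notMem_support_iff, notMem_support_iff] at hab
    rcases hab with hab | hab <;> simp [hab]

theorem noZeroDivisors_of_smul_injective [NoZeroDivisors k] [UniqueProds G]
    (hG : ∀ g : G, Function.Injective (g • · : k → k)) :
    NoZeroDivisors (SkewMonoidAlgebra k G) where
  eq_zero_or_eq_zero_of_mul_eq_zero {f g} hfg := by
    contrapose! hfg
    rw [Ne, ← support_eq_empty, Ne, ← support_eq_empty, ← Ne, ← Ne,
      ← Finset.nonempty_iff_ne_empty, ← Finset.nonempty_iff_ne_empty] at hfg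
    obtain ⟨a₀, ha, b₀, hb, h⟩ := UniqueProds.uniqueMul_of_nonempty hfg.1 hfg.2
    rw [mem_support_iff] at ha hb
    intro h0
    have := coeff_mul_mul_of_uniqueMul h
    rw [h0, coeff_zero, Finsupp.zero_apply, eq_comm, mul_eq_zero] at this
    rcases this with h' | h'
    · exact ha h'
    · exact hb (hG a₀ (by simpa using h'))

end SkewMonoidAlgebra

section SkewLaurent

open MvPolynomial

/-- The automorphism of `ℂ[X₀, X₁]` changing the sign of both variables. -/
noncomputable def signAut : MvPolynomial (Fin 2) ℂ ≃ₐ[ℂ] MvPolynomial (Fin 2) ℂ :=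
  AlgEquiv.ofAlgHom (aeval fun i ↦ -X i) (aeval fun i ↦ -X i)
    (by ext i : 1; simp) (by ext i : 1; simp)

@[simp]
theorem signAut_X (i : Fin 2) : signAut (X i) = -X i := by simp [signAut]

noncomputable instance signAction :
    MulSemiringAction (Multiplicative ℤ) (MvPolynomial (Fin 2) ℂ) :=
  MulSemiringAction.compHom _ (zpowersHom _ signAut)

theorem signAction_smul_def (n : Multiplicative ℤ) (p : MvPolynomial (Fin 2) ℂ) :
    n • p = (signAut ^ n.toAdd) p := rfl

@[simp]
theorem ofAdd_one_smul (p : MvPolynomial (Fin 2) ℂ) :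
    Multiplicative.ofAdd (1 : ℤ) • p = signAut p := by
  simp [signAction_smul_def]

theorem ofAdd_neg_one_smul_X (i : Fin 2) :
    Multiplicative.ofAdd (-1 : ℤ) • (X i : MvPolynomial (Fin 2) ℂ) = -X i := by
  rw [ofAdd_neg, inv_smul_eq_iff]
  simp

instance : SMulCommClass (Multiplicative ℤ) ℂ (MvPolynomial (Fin 2) ℂ) where
  smul_comm n z p := by simp [signAction_smul_def]

/-- The skew Laurent polynomial ring `ℂ[X₀, X₁][t, t⁻¹]` with `t * X i = -X i * t`. -/
abbrev SkewLaurent : Type := SkewMonoidAlgebra (MvPolynomial (Fin 2) ℂ) (Multiplicative ℤ)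

instance : NoZeroDivisors SkewLaurent :=
  SkewMonoidAlgebra.noZeroDivisors_of_smul_injective fun g ↦ MulAction.injective g

/-- The polynomial `1 - X₀ * X₁`. -/
noncomputable def detPoly : MvPolynomial (Fin 2) ℂ := 1 - X 0 * X 1

theorem detPoly_ne_zero : detPoly ≠ 0 := by
  intro h
  simpa [detPoly] using congrArg (eval 0) h

@[simp]
theorem smul_detPoly (n : Multiplicative ℤ) : n • detPoly = detPoly := by
  have h : Multiplicative.ofAdd (1 : ℤ) • detPoly = detPoly := by simp [detPoly]
  have hn : n = Multiplicative.ofAdd (1 : ℤ) ^ n.toAdd := by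
    rw [← ofAdd_zsmul]; simp
  rw [hn]
  exact MulAction.mem_stabilizer_iff.mp (zpow_mem (MulAction.mem_stabilizer_iff.mpr h) _)

open SkewMonoidAlgebra Multiplicative in
theorem SkewLaurent.slNegOneRel :
    SLNegOneRel (single (ofAdd 1) 1 : SkewLaurent) (single 1 (X 0)) (single 1 (X 1))
      (single (ofAdd (-1)) detPoly) := by
  have hone : (1 : SkewLaurent) - single 1 (X 0 * X 1) = single 1 detPoly := by
    rw [detPoly, sub_eq_add_neg 1 (X 0 * X 1 : MvPolynomial (Fin 2) ℂ), single_add, single_neg,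
      sub_eq_add_neg, SkewMonoidAlgebra.one_def]
  constructor <;> simp only [single_mul_single, ← single_neg, one_smul, mul_one, one_mul,
    ofAdd_one_smul, signAut_X, ofAdd_neg_one_smul_X, smul_detPoly, smul_one, hone,
    ← ofAdd_add, neg_add_cancel, add_neg_cancel, ofAdd_zero]
  · rw [mul_neg, mul_comm]
  · rw [mul_neg, mul_comm]
  · rw [mul_comm]

end SkewLaurent

section NormalForm

open MvPolynomial

/-- `a ^ n` for `0 ≤ n` and `d ^ (-n)` for `n ≤ 0`. -/
def slPow {M : Type*} [Monoid M] (a d : M) (n : ℤ) : M := a ^ n.toNat * d ^ (-n).toNat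

theorem slPow_natCast {M : Type*} [Monoid M] (a d : M) (n : ℕ) : slPow a d n = a ^ n := by
  simp [slPow]

theorem slPow_neg_natCast {M : Type*} [Monoid M] (a d : M) (n : ℕ) : slPow a d (-n) = d ^ n := by
  simp [slPow]

variable {A : Type*} [Ring A] [Algebra ℂ A] {a b c d : A}

open scoped IsMulCommutative in
theorem exists_algHom_mvPolynomial_of_commute (h : Commute b c) :
    ∃ f : MvPolynomial (Fin 2) ℂ →ₐ[ℂ] A, f (X 0) = b ∧ f (X 1) = c := by
  have hcomm : ∀ x ∈ ({b, c} : Set A), ∀ y ∈ ({b, c} : Set A), x * y = y * x := by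
    rintro x (rfl | rfl) y (rfl | rfl)
    exacts [rfl, h, h.symm, rfl]
  have := Algebra.isMulCommutative_adjoin ℂ hcomm
  let g : Fin 2 → Algebra.adjoin ℂ ({b, c} : Set A) :=
    ![⟨b, Algebra.subset_adjoin (by simp)⟩, ⟨c, Algebra.subset_adjoin (by simp)⟩]
  exact ⟨(Algebra.adjoin ℂ {b, c}).val.comp (aeval g), by simp [g], by simp [g]⟩

/-- The map `∑ pₙ n ↦ ∑ f pₙ * slPow a d n`. -/
noncomputable def normalForm (f : MvPolynomial (Fin 2) ℂ →ₐ[ℂ] A) (a d : A) :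
    (ℤ →₀ MvPolynomial (Fin 2) ℂ) →+ A :=
  Finsupp.liftAddHom fun n ↦ (AddMonoidHom.mulRight (slPow a d n)).comp (f : _ →+ A)

@[simp]
theorem normalForm_single (f : MvPolynomial (Fin 2) ℂ →ₐ[ℂ] A) (n : ℤ)
    (p : MvPolynomial (Fin 2) ℂ) :
    normalForm f a d (Finsupp.single n p) = f p * slPow a d n := by
  simp [normalForm]

theorem mul_algHom_eq_of_anticomm {f : MvPolynomial (Fin 2) ℂ →ₐ[ℂ] A}
    (ha : ∀ i, a * f (X i) = -(f (X i) * a)) (p : MvPolynomial (Fin 2) ℂ) :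
    a * f p = f (signAut p) * a := by
  induction p using MvPolynomial.induction_on with
  | C z =>
    rw [← algebraMap_eq, AlgEquiv.commutes, AlgHom.commutes, Algebra.commutes]
  | add p q hp hq => simp [mul_add, add_mul, hp, hq]
  | mul_X p i hp =>
    rw [map_mul, ← mul_assoc, hp, mul_assoc, ha, map_mul, map_mul, signAut_X, map_neg]
    simp [mul_assoc]

variable {f : MvPolynomial (Fin 2) ℂ →ₐ[ℂ] A}

theorem SLNegOneRel.mul_slPow_left (h : SLNegOneRel a b c d) (hb : f (X 0) = b) (hc : f (X 1) = c)
    (n : ℤ) : ∃ q, a * slPow a d n = f q * slPow a d (n + 1) := by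
  obtain ⟨m, rfl | rfl⟩ := n.eq_nat_or_neg
  · refine ⟨1, ?_⟩
    rw [slPow_natCast, ← Nat.cast_succ, slPow_natCast, pow_succ', map_one, one_mul]
  · cases m with
    | zero => exact ⟨1, by simp [slPow]⟩
    | succ m =>
      refine ⟨detPoly, ?_⟩
      rw [slPow_neg_natCast, Nat.cast_succ, neg_add, neg_add_cancel_right, slPow_neg_natCast,
        pow_succ', ← mul_assoc, h.ad]
      simp [detPoly, hb, hc]

theorem SLNegOneRel.mul_slPow_right (h : SLNegOneRel a b c d) (hb : f (X 0) = b)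
    (hc : f (X 1) = c) (n : ℤ) : ∃ q, d * slPow a d n = f q * slPow a d (n - 1) := by
  obtain ⟨m, rfl | rfl⟩ := n.eq_nat_or_neg
  · cases m with
    | zero => exact ⟨1, by simp [slPow]⟩
    | succ m =>
      refine ⟨detPoly, ?_⟩
      rw [slPow_natCast, Nat.cast_succ, add_sub_cancel_right, slPow_natCast,
        pow_succ', ← mul_assoc, h.da]
      simp [detPoly, hb, hc]
  · refine ⟨1, ?_⟩
    rw [slPow_neg_natCast, ← neg_add', ← Nat.cast_succ, slPow_neg_natCast, pow_succ', map_one,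
      one_mul]

theorem SLNegOneRel.normalForm_surjective (h : SLNegOneRel a b c d) (hb : f (X 0) = b)
    (hc : f (X 1) = c) (htop : Algebra.adjoin ℂ {a, b, c, d} = ⊤) :
    Function.Surjective (normalForm f a d) := by
  let M : AddSubmonoid A := AddMonoidHom.mrange (normalForm f a d)
  have hmem (p n) : f p * slPow a d n ∈ M := ⟨Finsupp.single n p, normalForm_single f n p⟩
  have key (y : A) (hy : ∀ p n, y * (f p * slPow a d n) ∈ M) : ∀ m ∈ M, y * m ∈ M := by
    rintro _ ⟨g, rfl⟩
    induction g using Finsupp.induction_linear with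
    | zero => simp
    | add g₁ g₂ h₁ h₂ => rw [map_add, mul_add]; exact add_mem h₁ h₂
    | single n p => rw [normalForm_single]; exact hy p n
  have hpoly (q) : ∀ m ∈ M, f q * m ∈ M := key _ fun p n ↦ by
    rw [← mul_assoc, ← map_mul]; exact hmem _ _
  have hgen : ∀ x : A, ∀ m ∈ M, x * m ∈ M := by
    intro x
    have hx : x ∈ Algebra.adjoin ℂ {a, b, c, d} := htop ▸ Algebra.mem_top
    induction hx using Algebra.adjoin_induction with
    | algebraMap r => rw [← f.commutes]; exact hpoly _
    | add x y _ _ hx hy => intro m hm; rw [add_mul]; exact add_mem (hx m hm) (hy m hm)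
    | mul x y _ _ hx hy => intro m hm; rw [mul_assoc]; exact hx _ (hy m hm)
    | mem x hx =>
      rcases hx with rfl | rfl | rfl | rfl
      · refine key _ fun p n ↦ ?_
        obtain ⟨q, hq⟩ := h.mul_slPow_left hb hc n
        rw [← mul_assoc, mul_algHom_eq_of_anticomm, mul_assoc, hq]
        · exact hpoly _ _ (hmem _ _)
        · simp [Fin.forall_fin_two, hb, hc, h.ab, h.ac]
      · rw [← hb]; exact hpoly _
      · rw [← hc]; exact hpoly _
      · refine key _ fun p n ↦ ?_
        obtain ⟨q, hq⟩ := h.mul_slPow_right hb hc n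
        rw [← mul_assoc, mul_algHom_eq_of_anticomm, mul_assoc, hq]
        · exact hpoly _ _ (hmem _ _)
        · simp [Fin.forall_fin_two, hb, hc, h.db, h.dc]
  intro x
  have h1 : (1 : A) ∈ M := by simpa [slPow] using hmem 1 0
  simpa [M] using hgen x 1 h1

open SkewMonoidAlgebra Multiplicative in
theorem SkewLaurent.slPow_eq (n : ℤ) :
    slPow (single (ofAdd 1) 1 : SkewLaurent) (single (ofAdd (-1)) detPoly) n =
      single (ofAdd n) (detPoly ^ (-n).toNat) := by
  have ha (m : ℕ) : (single (ofAdd 1) 1 : SkewLaurent) ^ m = single (ofAdd (m : ℤ)) 1 := by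
    induction m with
    | zero => simp
    | succ m ih => simp [pow_succ, ih, ofAdd_add]
  have hd (m : ℕ) : (single (ofAdd (-1)) detPoly : SkewLaurent) ^ m =
      single (ofAdd (-m : ℤ)) (detPoly ^ m) := by
    induction m with
    | zero => simp
    | succ m ih =>
      rw [pow_succ, ih, single_mul_single, smul_detPoly, ← ofAdd_add, pow_succ]
      congr 2
      push_cast
      ring
  rw [slPow, ha, hd, single_mul_single, smul_pow', smul_detPoly, one_mul, ← ofAdd_add]
  congr 2
  omega

open SkewMonoidAlgebra Multiplicative in
/-- A homomorphism to the skew Laurent polynomial ring matching the generators is injective. -/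
theorem SLNegOneRel.injective_skewLaurent (h : SLNegOneRel a b c d)
    (htop : Algebra.adjoin ℂ {a, b, c, d} = ⊤) (φ : A →ₐ[ℂ] SkewLaurent)
    (ha : φ a = single (ofAdd 1) 1) (hb : φ b = single 1 (X 0)) (hc : φ c = single 1 (X 1))
    (hd : φ d = single (ofAdd (-1)) detPoly) : Function.Injective φ := by
  obtain ⟨f, hfb, hfc⟩ := exists_algHom_mvPolynomial_of_commute (b := b) (c := c) h.cb.symm
  have hf (p : MvPolynomial (Fin 2) ℂ) : φ (f p) = single 1 p := by
    induction p using MvPolynomial.induction_on with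
    | C z => rw [← algebraMap_eq, AlgHom.commutes, AlgHom.commutes]; rfl
    | add p q hp hq => simp [hp, hq]
    | mul_X p i hp =>
      have hX : ∀ i, φ (f (X i)) = single 1 (X i) := by
        simp [Fin.forall_fin_two, hfb, hfc, hb, hc]
      rw [map_mul, map_mul, hp, hX, single_mul_single, one_smul, mul_one]
  have hpow (n : ℤ) : φ (slPow a d n) = single (ofAdd n) (detPoly ^ (-n).toNat) := by
    rw [← SkewLaurent.slPow_eq, slPow, slPow, map_mul, map_pow, map_pow, ha, hd]
  have hcoeff (g : ℤ →₀ MvPolynomial (Fin 2) ℂ) (n : ℤ) :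
      (φ (normalForm f a d g)).coeff (ofAdd n) = g n * detPoly ^ (-n).toNat := by
    induction g using Finsupp.induction_linear with
    | zero => simp
    | add g₁ g₂ h₁ h₂ => simp [h₁, h₂, add_mul]
    | single m p =>
      rw [normalForm_single, map_mul, hf, hpow, single_mul_single, one_smul, one_mul,
        coeff_single, Finsupp.single_apply, Finsupp.single_apply]
      by_cases hmn : m = n <;> simp [hmn]
  rw [injective_iff_map_eq_zero]
  intro x hx
  obtain ⟨g, rfl⟩ := h.normalForm_surjective hfb hfc htop x
  suffices g = 0 by rw [this, map_zero]
  ext1 n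
  have := hcoeff g n
  rw [hx, SkewMonoidAlgebra.coeff_zero, Finsupp.zero_apply, eq_comm, mul_eq_zero] at this
  exact this.resolve_right (pow_ne_zero _ detPoly_ne_zero)

end NormalForm

section OrthogonalMatrix

open Complex

variable {A : Type*} [Ring A] [Algebra ℂ A]

theorem orthTwoRel_of_matrix {u : Fin 2 → Fin 2 → A}
    (hcol : ∀ i j, ∑ k, u k i * u k j = if i = j then 1 else 0)
    (hrow : ∀ i j, ∑ k, u i k * u j k = if i = j then 1 else 0) :
    OrthTwoRel (u 0 0) (I • u 0 1) (I • u 1 0) (u 1 1) := by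
  simp only [Fin.sum_univ_two] at hcol hrow
  have hI (y z : A) : (I • y) * (I • z) = -(y * z) := by
    rw [smul_mul_smul_comm, I_mul_I, neg_one_smul]
  constructor <;> simp only [hI, smul_mul_assoc, mul_smul_comm, ← smul_add, sub_neg_eq_add]
  · simpa using hcol 0 0
  · simpa [add_comm] using hcol 1 1
  · simpa using hrow 0 0
  · simpa [add_comm] using hrow 1 1
  · simp [hcol 0 1]
  · simp [hcol 1 0]
  · simp [hrow 0 1]
  · simp [hrow 1 0]

theorem OrthTwoRel.matrix_mul {x p r w : A} (h : OrthTwoRel x p r w) (i j : Fin 2) :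
    ∑ k, !![x, -I • p; -I • r, w] k i * !![x, -I • p; -I • r, w] k j = (if i = j then 1 else 0) ∧
    ∑ k, !![x, -I • p; -I • r, w] i k * !![x, -I • p; -I • r, w] j k =
      (if i = j then 1 else 0) := by
  have h1 := h.xr
  have h2 := h.wp
  have h3 := h.xp
  have h4 := h.wr
  rw [sub_eq_add_neg] at h1 h3
  rw [sub_eq_neg_add] at h2 h4
  have h5 := h.xp_rw
  have h6 := h.px_wr
  have h7 := h.xr_pw
  have h8 := h.rx_wp
  fin_cases i <;> fin_cases j <;>
    simp [Fin.sum_univ_two, smul_smul, ← neg_add, ← smul_add, h1, h2, h3, h4, h5,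
      h6, h7, h8]

end OrthogonalMatrix

namespace PolO

open Complex

theorem sum_vO_mul_vO_col (n : ℕ) (i j : Fin n) :
    ∑ k, vO n k i * vO n k j = if i = j then 1 else 0 := by
  simpa [vO, apply_ite] using RingQuot.mkAlgHom_rel ℂ (Orel.col i j)

theorem sum_vO_mul_vO_row (n : ℕ) (i j : Fin n) :
    ∑ k, vO n i k * vO n j k = if i = j then 1 else 0 := by
  simpa [vO, apply_ite] using RingQuot.mkAlgHom_rel ℂ (Orel.row i j)

theorem adjoin_vO (n : ℕ) : Algebra.adjoin ℂ {x | ∃ i j, vO n i j = x} = ⊤ := by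
  rw [eq_top_iff, ← (AlgHom.range_eq_top _).mpr (RingQuot.mkAlgHom_surjective ℂ (Orel n)),
    ← Algebra.map_top, ← FreeAlgebra.adjoin_range_ι, AlgHom.map_adjoin, ← Set.range_comp]
  refine Algebra.adjoin_mono ?_
  rintro _ ⟨⟨i, j⟩, rfl⟩
  exact ⟨i, j, rfl⟩

/-- An orthogonal matrix over `A` determines a homomorphism `Pol(O_n⁺) → A`. -/
theorem exists_algHom {A : Type*} [Ring A] [Algebra ℂ A] {n : ℕ} (u : Fin n → Fin n → A)
    (hcol : ∀ i j, ∑ k, u k i * u k j = if i = j then 1 else 0)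
    (hrow : ∀ i j, ∑ k, u i k * u j k = if i = j then 1 else 0) :
    ∃ φ : PolO n →ₐ[ℂ] A, ∀ i j, φ (vO n i j) = u i j := by
  refine ⟨RingQuot.liftAlgHom ℂ ⟨FreeAlgebra.lift ℂ fun | .v i j => u i j, ?_⟩, fun i j ↦ ?_⟩
  · rintro _ _ (⟨i, j⟩ | ⟨i, j⟩)
    · simpa [apply_ite] using hcol i j
    · simpa [apply_ite] using hrow i j
  · simp [vO]

theorem exists_injective_skewLaurent :
    ∃ φ : PolO 2 →ₐ[ℂ] SkewLaurent, Function.Injective φ := by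
  have hS := SkewLaurent.slNegOneRel.orthTwoRel
  obtain ⟨φ, hφ⟩ := exists_algHom _ (fun i j ↦ (hS.matrix_mul i j).1)
    (fun i j ↦ (hS.matrix_mul i j).2)
  have h := (orthTwoRel_of_matrix (sum_vO_mul_vO_col 2) (sum_vO_mul_vO_row 2)).slNegOneRel
  have hI (y : SkewLaurent) : I • -I • y = y := by
    rw [smul_smul, mul_neg, I_mul_I, neg_neg, one_smul]
  obtain ⟨ha, hb, hc, hd⟩ := map_changeOfGenerators φ (hφ 0 0) (p := I • vO 2 0 1)
    (r := I • vO 2 1 0) (by rw [map_smul, hφ]; exact hI _) (by rw [map_smul, hφ]; exact hI _)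
    (hφ 1 1)
  refine ⟨φ, h.injective_skewLaurent ?_ φ ha hb hc hd⟩
  rw [eq_top_iff, ← adjoin_vO, Algebra.adjoin_le_iff]
  have hmem := mem_adjoin_changeOfGenerators (vO 2 0 0) (I • vO 2 0 1) (I • vO 2 1 0) (vO 2 1 1)
  simp only [Set.insert_subset_iff, Set.singleton_subset_iff, SetLike.mem_coe] at hmem
  obtain ⟨hx, hp, hr, hw⟩ := hmem
  rintro _ ⟨i, j, rfl⟩
  fin_cases i <;> fin_cases j
  · exact hx
  · simpa [smul_smul] using Subalgebra.smul_mem _ hp (-I)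
  · simpa [smul_smul] using Subalgebra.smul_mem _ hr (-I)
  · exact hw

end PolO

/-- The ring `Pol(O_2⁺)` is a domain. -/
theorem polO_two_isDomain :
    Nontrivial (PolO 2) ∧ ∀ x y : PolO 2, x * y = 0 → x = 0 ∨ y = 0 := by
  obtain ⟨φ, hφ⟩ := PolO.exists_injective_skewLaurent
  have : NoZeroDivisors (PolO 2) := hφ.noZeroDivisors φ (map_zero φ) (map_mul φ)
  exact ⟨φ.toRingHom.domain_nontrivial, fun x y ↦ mul_eq_zero.mp⟩
end
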